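/- arXiv:1108.2858 — 4 statements merged into one kernel-verified Lean document; each statement's English description precedes it below -/
import Mathlib

section
/- For real constants a ≥ b ≥ 0, the function p ↦ log(1 + a·p) − log(1 + b·p) is concave on [0, ∞). (This is the per-sub-carrier secrecy rate achieved by Gaussian distributed inputs, with a = |h_i|² the legitimate channel gain and b = |g_i|² the eavesdropper channel gain.) -/
theorem hasDerivAt_log_one_add_mul_sub_log_one_add_mul {a b x : ℝ}
    (ha : 0 < 1 + a * x) (hb : 0 < 1 + b * x) :
    HasDerivAt (fun p => Real.log (1 + a * p) - Real.log (1 + b * p))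
      ((a - b) / ((1 + a * x) * (1 + b * x))) x := by
  have hlin (c : ℝ) : HasDerivAt (fun p => 1 + c * p) c x := by
    simpa using ((hasDerivAt_id x).const_mul c).const_add 1
  refine (((hlin a).log ha.ne').sub ((hlin b).log hb.ne')).congr_deriv ?_
  rw [div_sub_div _ _ ha.ne' hb.ne']
  ring

/-- For `a ≥ b ≥ 0`, the Gaussian-input per-sub-carrier secrecy rate
`p ↦ log (1 + a p) - log (1 + b p)` is concave on `[0, ∞)`. -/
theorem gaussian_secrecy_rate_concaveOn (a b : ℝ) (hab : b ≤ a) (hb : 0 ≤ b) :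
    ConcaveOn ℝ (Set.Ici (0 : ℝ))
      (fun p => Real.log (1 + a * p) - Real.log (1 + b * p)) := by
  have ha : 0 ≤ a := hb.trans hab
  have hderiv : ∀ x : ℝ, 0 ≤ x →
      HasDerivAt (fun p => Real.log (1 + a * p) - Real.log (1 + b * p))
        ((a - b) / ((1 + a * x) * (1 + b * x))) x := fun x hx =>
    hasDerivAt_log_one_add_mul_sub_log_one_add_mul (by positivity) (by positivity)
  refine AntitoneOn.concaveOn_of_deriv (convex_Ici 0)
    (fun x hx => (hderiv x hx).continuousAt.continuousWithinAt)
    (fun x hx => (hderiv x (interior_subset hx)).differentiableAt.differentiableWithinAt) ?_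
  intro x hx y hy hxy
  have hx₀ : 0 ≤ x := interior_subset hx
  have hy₀ : 0 ≤ y := interior_subset hy
  rw [(hderiv x hx₀).deriv, (hderiv y hy₀).deriv]
  have hsub : 0 ≤ a - b := sub_nonneg.mpr hab
  gcongr
end

section
/- For any real constants a ≥ 0 and b ≥ 0, the function p ↦ max(log(1 + a·p) − log(1 + b·p), 0) is concave on [0, ∞). (If a ≥ b the positive part is redundant since the difference is nonnegative and concave; if a < b the difference is nonpositive so the function is identically 0.) -/
theorem concaveOn_log_one_add_mul_sub_log_one_add_mul {a b : ℝ} (hb : 0 ≤ b) (hab : b ≤ a) :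
    ConcaveOn ℝ (Set.Ici (0 : ℝ)) (fun p => Real.log (1 + a * p) - Real.log (1 + b * p)) := by
  have hpos {c p : ℝ} (hc : 0 ≤ c) (hp : 0 ≤ p) : 0 < 1 + c * p := by positivity
  have hlin (c p : ℝ) : HasDerivAt (fun p => 1 + c * p) c p := by
    simpa using ((hasDerivAt_id p).const_mul c).const_add 1
  have ha : 0 ≤ a := hb.trans hab
  refine concaveOn_of_hasDerivWithinAt2_nonpos (convex_Ici 0)
    (f' := fun p => a / (1 + a * p) - b / (1 + b * p))
    (f'' := fun p => (b / (1 + b * p)) ^ 2 - (a / (1 + a * p)) ^ 2) ?_ ?_ ?_ ?_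
  · refine ContinuousOn.sub ?_ ?_
    · exact ContinuousOn.log (by fun_prop) fun p hp => (hpos ha hp).ne'
    · exact ContinuousOn.log (by fun_prop) fun p hp => (hpos hb hp).ne'
  all_goals
    intro p hp
    rw [interior_Ici] at hp
    have hap := hpos ha hp.le
    have hbp := hpos hb hp.le
  · exact (((hlin a p).log hap.ne').sub ((hlin b p).log hbp.ne')).hasDerivWithinAt
  · have h := ((hasDerivAt_const p a).div (hlin a p) hap.ne').sub
      ((hasDerivAt_const p b).div (hlin b p) hbp.ne')
    refine (h.congr_deriv ?_).hasDerivWithinAt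
    field_simp
    ring
  · have h : b / (1 + b * p) ≤ a / (1 + a * p) := by
      rw [div_le_div_iff₀ hbp hap]
      linarith
    exact sub_nonpos.2 (pow_le_pow_left₀ (div_nonneg hb hbp.le) h 2)

/-- For `a ≥ 0` and `b ≥ 0`, the positive part of the Gaussian-input per-sub-carrier
secrecy rate `p ↦ max (log (1 + a p) - log (1 + b p)) 0` is concave on `[0, ∞)`. -/
theorem gaussian_secrecy_rate_posPart_concaveOn (a b : ℝ) (ha : 0 ≤ a) (hb : 0 ≤ b) :
    ConcaveOn ℝ (Set.Ici (0 : ℝ))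
      (fun p => max (Real.log (1 + a * p) - Real.log (1 + b * p)) 0) := by
  have hlog {c d p : ℝ} (hc : 0 ≤ c) (hcd : c ≤ d) (hp : 0 ≤ p) :
      Real.log (1 + c * p) ≤ Real.log (1 + d * p) :=
    Real.log_le_log (by positivity) (by gcongr)
  rcases le_total b a with hab | hab
  · exact (concaveOn_log_one_add_mul_sub_log_one_add_mul hb hab).congr fun p hp =>
      (max_eq_left (sub_nonneg.2 (hlog hb hab hp))).symm
  · exact (concaveOn_const 0 (convex_Ici 0)).congr fun p hp =>
      (max_eq_right (sub_nonpos.2 (hlog ha hab hp))).symm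
end

section
/- Let N be a positive natural number and let a_i ≥ 0, b_i ≥ 0 for i = 1,…,N. Then the Gaussian-input secrecy rate function R^G_s(p) = (1/N) · Σ_{i=1}^N max(log(1 + a_i·p_i) − log(1 + b_i·p_i), 0) is concave on the nonnegative orthant {p ∈ ℝ^N : p_i ≥ 0 for all i}. -/
open Finset

/-- The map `x ↦ x / (1 + b x)` is concave on the nonnegative half-line when `b ≥ 0`. -/
theorem concaveOn_div_one_add_mul {b : ℝ} (hb : 0 ≤ b) :
    ConcaveOn ℝ (Set.Ici 0) (fun x : ℝ => x / (1 + b * x)) := by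
  refine ⟨convex_Ici 0, fun x hx y hy s t hs ht hst => ?_⟩
  rw [Set.mem_Ici] at hx hy
  obtain rfl : t = 1 - s := by linarith
  have hx' : 0 < 1 + b * x := by positivity
  have hy' : 0 < 1 + b * y := by positivity
  have hz' : 0 < 1 + b * (s * x + (1 - s) * y) := by positivity
  simp only [smul_eq_mul]
  rw [mul_div_assoc', mul_div_assoc', div_add_div _ _ hx'.ne' hy'.ne',
    div_le_div_iff₀ (mul_pos hx' hy') hz', ← sub_nonneg]
  have key : 0 ≤ b * (s * (1 - s)) * (x - y) ^ 2 := by positivity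
  linear_combination key

/-- The difference `log (1 + a x) - log (1 + b x)` is concave on the nonnegative half-line when
`0 ≤ b ≤ a`. -/
theorem concaveOn_log_one_add_mul_sub {a b : ℝ} (hb : 0 ≤ b) (hab : b ≤ a) :
    ConcaveOn ℝ (Set.Ici 0) (fun x : ℝ => Real.log (1 + a * x) - Real.log (1 + b * x)) := by
  have hpos : ∀ x ∈ Set.Ici (0 : ℝ), 0 < 1 + (a - b) * (x / (1 + b * x)) := by
    intro x hx
    rw [Set.mem_Ici] at hx
    have := sub_nonneg.2 hab
    positivity
  have hlog : ConcaveOn ℝ (Set.Ici 0)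
      (fun x : ℝ => Real.log (1 + (a - b) * (x / (1 + b * x)))) := by
    refine ⟨convex_Ici 0, fun x hx y hy s t hs ht hst => ?_⟩
    have hz := convex_Ici (0 : ℝ) hx hy hs ht hst
    have hc := mul_le_mul_of_nonneg_left
      ((concaveOn_div_one_add_mul hb).2 hx hy hs ht hst) (sub_nonneg.2 hab)
    refine (strictConcaveOn_log_Ioi.concaveOn.2 (hpos x hx) (hpos y hy) hs ht hst).trans ?_
    refine Real.log_le_log
      (convex_Ioi (0 : ℝ) (hpos x hx) (hpos y hy) hs ht hst) ?_
    simp only [smul_eq_mul] at hc ⊢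
    linear_combination hc + hst
  refine hlog.congr fun x hx => ?_
  rw [Set.mem_Ici] at hx
  have hx' : 0 < 1 + b * x := by positivity
  have hax : 0 < 1 + a * x := by have := hb.trans hab; positivity
  dsimp only
  rw [← Real.log_div hax.ne' hx'.ne']
  congr 1
  field_simp
  ring

/-- The positive part of `log (1 + a x) - log (1 + b x)` is concave on the nonnegative
half-line. -/
theorem concaveOn_max_log_one_add_mul_sub {a b : ℝ} (ha : 0 ≤ a) (hb : 0 ≤ b) :
    ConcaveOn ℝ (Set.Ici 0)
      (fun x : ℝ => max (Real.log (1 + a * x) - Real.log (1 + b * x)) 0) := by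
  rcases le_total b a with hab | hab
  · refine (concaveOn_log_one_add_mul_sub hb hab).congr fun x hx => ?_
    rw [Set.mem_Ici] at hx
    exact (max_eq_left (sub_nonneg.2 (Real.log_le_log (by positivity) (by gcongr)))).symm
  · refine (concaveOn_const (0 : ℝ) (convex_Ici 0)).congr fun x hx => ?_
    rw [Set.mem_Ici] at hx
    exact (max_eq_right (sub_nonpos.2 (Real.log_le_log (by positivity) (by gcongr)))).symm

/-- The Gaussian-input secrecy rate
`R^G_s(p) = (1/N) ∑ i, [log (1 + a i * p i) - log (1 + b i * p i)]⁺`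
is concave on the nonnegative orthant of `ℝ^N`. -/
theorem gaussian_secrecy_rate_sum_concaveOn (N : ℕ) (hN : 0 < N)
    (a b : Fin N → ℝ) (ha : ∀ i, 0 ≤ a i) (hb : ∀ i, 0 ≤ b i) :
    ConcaveOn ℝ {p : Fin N → ℝ | ∀ i, 0 ≤ p i}
      (fun p => (1 / (N : ℝ)) *
        ∑ i, max (Real.log (1 + a i * p i) - Real.log (1 + b i * p i)) 0) := by
  refine ⟨fun p hp q hq s t hs ht _ i => ?_, fun p hp q hq s t hs ht hst => ?_⟩
  · exact add_nonneg (mul_nonneg hs (hp i)) (mul_nonneg ht (hq i))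
  · have h := Finset.sum_le_sum fun i (_ : i ∈ Finset.univ) =>
      (concaveOn_max_log_one_add_mul_sub (ha i) (hb i)).2 (hp i) (hq i) hs ht hst
    simp only [smul_eq_mul, Finset.sum_add_distrib, ← Finset.mul_sum] at h
    have hN' : 0 ≤ 1 / (N : ℝ) := by positivity
    simp only [smul_eq_mul, Pi.add_apply, Pi.smul_apply]
    linear_combination mul_le_mul_of_nonneg_left h hN'
end

section
/- Let a > b > 0 and 0 < u < a − b be real numbers, and let p* = (−(a + b) + √((a + b)² − 4ab(u + b − a)/u)) / (2ab). Then p* is a global maximizer of φ(p) = log(1 + a·p) − log(1 + b·p) − u·p over [0, ∞): for every p ≥ 0, φ(p) ≤ φ(p*). (This is the positive branch of the paper's optimal Gaussian-input power allocation formula (9).) -/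
/-- A nonnegative stationary point of `log (1 + a p) - log (1 + b p) - u p` is a global
maximizer over `[0, ∞)`. -/
theorem log_sub_log_sub_mul_le_of_stationary {a b u p q : ℝ} (hba : b ≤ a) (hb : 0 ≤ b)
    (hp : 0 ≤ p) (hq : 0 ≤ q) (h : u * ((1 + a * q) * (1 + b * q)) = a - b) :
    Real.log (1 + a * p) - Real.log (1 + b * p) - u * p ≤
      Real.log (1 + a * q) - Real.log (1 + b * q) - u * q := by
  have ha : 0 ≤ a := hb.trans hba
  have hap : 0 < 1 + a * p := by positivity
  have hbp : 0 < 1 + b * p := by positivity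
  have haq : 0 < 1 + a * q := by positivity
  have hbq : 0 < 1 + b * q := by positivity
  have hlog := Real.log_le_sub_one_of_pos
    (show 0 < ((1 + a * p) * (1 + b * q)) / ((1 + b * p) * (1 + a * q)) by positivity)
  rw [Real.log_div (by positivity) (by positivity), Real.log_mul hap.ne' hbq.ne',
    Real.log_mul hbp.ne' haq.ne'] at hlog
  have hu : u = (a - b) / ((1 + a * q) * (1 + b * q)) := by
    rw [eq_div_iff (by positivity), h]
  have hgap : u * (p - q) - (((1 + a * p) * (1 + b * q)) / ((1 + b * p) * (1 + a * q)) - 1) =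
      (a - b) * b * (p - q) ^ 2 / ((1 + a * q) * (1 + b * q) * (1 + b * p)) := by
    rw [hu]
    field_simp
    ring
  have hnonneg : 0 ≤ (a - b) * b * (p - q) ^ 2 / ((1 + a * q) * (1 + b * q) * (1 + b * p)) := by
    have := sub_nonneg.2 hba
    positivity
  linarith

/-- For `a > b > 0` and `0 < u < a - b`, the power level
`p* = (-(a + b) + √((a + b)² - 4ab(u + b - a)/u)) / (2ab)` globally maximizes the
per-sub-carrier Lagrangian `φ(p) = log (1 + a p) - log (1 + b p) - u p` over `[0, ∞)`. -/
theorem gaussian_waterfilling_global_max (a b u : ℝ) (hba : b < a) (hb : 0 < b)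
    (hu : 0 < u) (hu' : u < a - b) :
    ∀ p : ℝ, 0 ≤ p →
      Real.log (1 + a * p) - Real.log (1 + b * p) - u * p ≤
        Real.log (1 + a * ((-(a + b) +
            Real.sqrt ((a + b) ^ 2 - 4 * a * b * (u + b - a) / u)) / (2 * a * b))) -
          Real.log (1 + b * ((-(a + b) +
            Real.sqrt ((a + b) ^ 2 - 4 * a * b * (u + b - a) / u)) / (2 * a * b))) -
          u * ((-(a + b) +
            Real.sqrt ((a + b) ^ 2 - 4 * a * b * (u + b - a) / u)) / (2 * a * b)) := by
  intro p hp
  have ha : 0 < a := hb.trans hba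
  have hD : (a + b) ^ 2 ≤ (a + b) ^ 2 - 4 * a * b * (u + b - a) / u := by
    have : 4 * a * b * (u + b - a) / u ≤ 0 :=
      div_nonpos_of_nonpos_of_nonneg
        (mul_nonpos_of_nonneg_of_nonpos (by positivity) (by linarith)) hu.le
    linarith
  have hs := Real.sq_sqrt ((sq_nonneg (a + b)).trans hD)
  have hle := Real.le_sqrt_of_sq_le hD
  set s := Real.sqrt ((a + b) ^ 2 - 4 * a * b * (u + b - a) / u)
  refine log_sub_log_sub_mul_le_of_stationary hba.le hb.le hp
    (div_nonneg (by linarith) (by positivity)) ?_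
  have hprod : (1 + a * ((-(a + b) + s) / (2 * a * b))) *
      (1 + b * ((-(a + b) + s) / (2 * a * b))) = (s ^ 2 - (a - b) ^ 2) / (4 * a * b) := by
    field_simp
    ring
  rw [hprod, hs]
  field_simp
  ring
end
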